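/- Computational τ-closure is correct: for every automaton M and node s, tauclose_comp M s = tauclose M s; i.e., iterating tauclose_step M s starting from the empty set until a fixpoint is reached computes the least fixpoint tauclose M s. -/

import Mathlib

/-! Automata with a background state, actions, and τ-closure. -/

abbrev vname := String

inductive val where
  | Bool : Bool → val
  | Null : val
deriving DecidableEq

inductive action where
  | NoAct : action
  | AssAct : vname → val → action
deriving DecidableEq

structure edge (n : Type) where
  source : n
  action : action
  dest : n
deriving DecidableEq

structure ta (n : Type) where
  nodes : List n
  edges : List (edge n)
  init_s : n

/-- One step of the τ-closure computation: add `s` and all nodes reachable from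
`x` by one silent transition. -/
def tauclose_step {n : Type} (M : ta n) (s : n) (x : Set n) : Set n :=
  {s} ∪ x ∪ {nd | nd ∈ M.nodes ∧
    ∃ e ∈ M.edges, e.source ∈ x ∧ e.action = action.NoAct ∧ e.dest = nd}

lemma mono_tauclose_step {n : Type} (M : ta n) (s : n) :
    Monotone (tauclose_step M s) := by
  intro x y hxy
  rintro nd (h | ⟨hnd, e, he, hsrc, hact, hdst⟩)
  · exact Or.inl (by rcases h with h | h; exact Or.inl h; exact Or.inr (hxy h))
  · exact Or.inr ⟨hnd, e, he, hxy hsrc, hact, hdst⟩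

/-- The τ-closure of a node: least fixpoint of `tauclose_step`. -/
def tauclose {n : Type} (M : ta n) (s : n) : Set n :=
  OrderHom.lfp ⟨tauclose_step M s, mono_tauclose_step M s⟩
section TaucloseComp

open Classical in
/-- Computational version of the τ-closure: iterate `tauclose_step M s` on an
accumulator until a fixpoint is reached.  Termination is by the number of
elements of `s :: nodes M` not yet in the accumulator. -/
noncomputable def tauclose_comp_aux {n : Type} (M : ta n) (s : n) (x : Set n) : Set n :=
  if h : tauclose_step M s x = x then x
  else tauclose_comp_aux M s (tauclose_step M s x)
termination_by ((insert s M.nodes.toFinset).filter (fun v => v ∉ x)).card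
decreasing_by
  have hsub : x ⊆ tauclose_step M s x := fun a ha => Or.inl (Or.inr ha)
  obtain ⟨c, hcstep, hcx⟩ :=
    Set.exists_of_ssubset (hsub.ssubset_of_ne (fun e => h e.symm))
  have hcS : c ∈ insert s M.nodes.toFinset := by
    rcases hcstep with (hc | hc) | ⟨hc, _⟩
    · exact Finset.mem_insert.mpr (Or.inl hc)
    · exact absurd hc hcx
    · exact Finset.mem_insert.mpr (Or.inr (List.mem_toFinset.mpr hc))
  apply Finset.card_lt_card
  constructor
  · intro a ha
    rw [Finset.mem_filter] at ha ⊢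
    exact ⟨ha.1, fun hax => ha.2 (hsub hax)⟩
  · intro hcontra
    have hcmem : c ∈ (insert s M.nodes.toFinset).filter (fun v => v ∉ x) :=
      Finset.mem_filter.mpr ⟨hcS, hcx⟩
    have := Finset.mem_filter.mp (hcontra hcmem)
    exact this.2 hcstep

end TaucloseComp

/-- τ-closure computed by iteration from the empty accumulator. -/
noncomputable def tauclose_comp {n : Type} (M : ta n) (s : n) : Set n :=
  tauclose_comp_aux M s ∅

/-- Iterating `tauclose_step` from any set below the least fixpoint reaches the least fixpoint. -/
lemma tauclose_comp_aux_eq_tauclose {n : Type} (M : ta n) (s : n) (x : Set n)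
    (hx : x ⊆ tauclose M s) : tauclose_comp_aux M s x = tauclose M s := by
  induction x using tauclose_comp_aux.induct M s with
  | case1 x h =>
    rw [tauclose_comp_aux, dif_pos h]
    exact hx.antisymm (OrderHom.lfp_le ⟨tauclose_step M s, mono_tauclose_step M s⟩ h.le)
  | case2 x h ih =>
    rw [tauclose_comp_aux, dif_neg h]
    exact ih ((mono_tauclose_step M s hx).trans
      (OrderHom.map_lfp ⟨tauclose_step M s, mono_tauclose_step M s⟩).le)

/-- Computational τ-closure is correct: iterating
`tauclose_step M s` starting from the empty set computes the least fixpoint. -/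
theorem tauclose_comp_sound {n : Type} (M : ta n) (s : n) :
    tauclose_comp M s = tauclose M s := by
  exact tauclose_comp_aux_eq_tauclose M s ∅ (Set.empty_subset _)
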